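/- arXiv:2504.09576 — 2 statements merged into one kernel-verified Lean document; each statement's English description precedes it below -/
import Mathlib

section
/- Let Φ be a quantum channel on M_n(ℂ) and let D ∈ M_n(ℂ) be positive definite with Tr(D Φ(x)) = Tr(D x) for all x ∈ M_n(ℂ). If Φ(x) = x, then Φ(x* x) = x* x and Φ(x x*) = x x*. -/
open Matrix
open scoped ComplexOrder

noncomputable section

/-- `Mat n` is the algebra of complex `n × n` matrices. -/
abbrev Mat (n : ℕ) : Type := Matrix (Fin n) (Fin n) ℂ

/-- Blockwise application of a linear map on `Mat n` to a `k × k` block matrix with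
`n × n` blocks (i.e. the map `Φ ⊗ id_k`). -/
def blockMap (n k : ℕ) (Φ : Mat n →ₗ[ℂ] Mat n)
    (X : Matrix (Fin k × Fin n) (Fin k × Fin n) ℂ) :
    Matrix (Fin k × Fin n) (Fin k × Fin n) ℂ :=
  Matrix.of fun p q => Φ (Matrix.of fun i j => X (p.1, i) (q.1, j)) p.2 q.2

/-- A linear map on `Mat n` is completely positive if its blockwise application to any
positive semidefinite `k × k` block matrix is positive semidefinite. -/
def IsCompletelyPositive (n : ℕ) (Φ : Mat n →ₗ[ℂ] Mat n) : Prop :=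
  ∀ k : ℕ, 1 ≤ k → ∀ X : Matrix (Fin k × Fin n) (Fin k × Fin n) ℂ,
    X.PosSemidef → (blockMap n k Φ X).PosSemidef

/-- A quantum channel is a unital completely positive linear map. -/
def IsQuantumChannel (n : ℕ) (Φ : Mat n →ₗ[ℂ] Mat n) : Prop :=
  IsCompletelyPositive n Φ ∧ Φ 1 = 1

theorem ks_aux {n : ℕ} (Φ : Mat n →ₗ[ℂ] Mat n) (hΦ : IsQuantumChannel n Φ) (x : Mat n) :
    Φ xᴴ = (Φ x)ᴴ ∧ (Φ (xᴴ * x) - (Φ x)ᴴ * Φ x).PosSemidef := by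
  obtain ⟨hcp, h1⟩ := hΦ
  let V : Matrix (Fin n) (Fin 2 × Fin n) ℂ := Matrix.of fun i q => (![(1 : Mat n), x] q.1) i q.2
  have hV := hcp 2 (by norm_num) (Vᴴ * V) (Matrix.posSemidef_conjTranspose_mul_self V)
  have hblk : ∀ a b : Fin 2, (Matrix.of fun i j => (Vᴴ * V) (a, i) (b, j)) =
      (![(1 : Mat n), x] a)ᴴ * (![(1 : Mat n), x] b) := by
    intro a b
    ext i j
    simp [V, Matrix.mul_apply]
  have hent : ∀ (a b : Fin 2) (i j : Fin n), blockMap n 2 Φ (Vᴴ * V) (a, i) (b, j) =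
      Φ ((![(1 : Mat n), x] a)ᴴ * (![(1 : Mat n), x] b)) i j := by
    intro a b i j
    rw [← hblk]
    rfl
  have hstar : Φ xᴴ = (Φ x)ᴴ := by
    ext i j
    have h := hV.1.apply (1, i) (0, j)
    rw [hent, hent] at h
    simpa using h.symm
  refine ⟨hstar, ?_⟩
  let W : Matrix (Fin 2 × Fin n) (Fin n) ℂ := Matrix.of fun q i => (![-Φ x, (1 : Mat n)] q.1) q.2 i
  have hW := hV.conjTranspose_mul_mul_same W
  have hmul : blockMap n 2 Φ (Vᴴ * V) * W =
      Matrix.of fun q i => (![(0 : Mat n), Φ (xᴴ * x) - (Φ x)ᴴ * Φ x] q.1) q.2 i := by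
    ext ⟨a, i⟩ j
    rw [Matrix.mul_apply, Fintype.sum_prod_type]
    simp only [hent, Fin.sum_univ_two]
    fin_cases a
    · simp [W, h1, Matrix.one_apply]
    · simp [W, hstar, Matrix.one_apply, Matrix.mul_apply]
      ring
  convert hW using 1
  rw [Matrix.mul_assoc, hmul]
  ext i j
  rw [Matrix.mul_apply, Fintype.sum_prod_type]
  simp [W, Matrix.one_apply]

open scoped MatrixOrder Matrix.Norms.L2Operator in
theorem faithful_aux {n : ℕ} (D P : Mat n) (hD : D.PosDef) (hP : P.PosSemidef)
    (h : (D * P).trace = 0) : P = 0 := by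
  obtain ⟨B, rfl⟩ := CStarAlgebra.nonneg_iff_eq_star_mul_self.mp hP.nonneg
  rw [Matrix.star_eq_conjTranspose] at *
  have h2 : (B * D * Bᴴ).trace = 0 := by
    rw [Matrix.mul_assoc, Matrix.trace_mul_comm, Matrix.mul_assoc, h]
  have h3 := (hD.posSemidef.mul_mul_conjTranspose_same B).trace_eq_zero_iff.mp h2
  have h4 : Bᴴ = 0 := by
    apply Matrix.ext_of_mulVec_single
    intro i
    by_contra hne
    rw [Matrix.zero_mulVec] at hne
    have := hD.dotProduct_mulVec_pos hne
    rw [Matrix.star_mulVec, Matrix.conjTranspose_conjTranspose, ← Matrix.dotProduct_mulVec,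
      Matrix.mulVec_mulVec, Matrix.mulVec_mulVec, h3] at this
    simp at this
  rw [h4, Matrix.zero_mul]

theorem half_aux {n : ℕ} (Φ : Mat n →ₗ[ℂ] Mat n)
    (hΦ : IsQuantumChannel n Φ) (D : Mat n) (hD : D.PosDef)
    (hinv : ∀ x : Mat n, (D * Φ x).trace = (D * x).trace)
    (x : Mat n) (hx : Φ x = x) : Φ (xᴴ * x) = xᴴ * x := by
  have h := (ks_aux Φ hΦ x).2
  rw [hx] at h
  refine sub_eq_zero.mp (faithful_aux D _ hD h ?_)
  rw [Matrix.mul_sub, Matrix.trace_sub, hinv, sub_self]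

/-- For a quantum channel `Φ` with a faithful invariant state, every fixed point `x`
lies in the multiplicative domain: `Φ(x* x) = x* x` and `Φ(x x*) = x x*`. -/
theorem fixedPoint_mem_multiplicativeDomain {n : ℕ} (Φ : Mat n →ₗ[ℂ] Mat n)
    (hΦ : IsQuantumChannel n Φ) (D : Mat n) (hD : D.PosDef)
    (hinv : ∀ x : Mat n, (D * Φ x).trace = (D * x).trace)
    (x : Mat n) (hx : Φ x = x) :
    Φ (xᴴ * x) = xᴴ * x ∧ Φ (x * xᴴ) = x * xᴴ := by
  refine ⟨half_aux Φ hΦ D hD hinv x hx, ?_⟩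
  have h := half_aux Φ hΦ D hD hinv xᴴ (by rw [(ks_aux Φ hΦ x).1, hx])
  rwa [Matrix.conjTranspose_conjTranspose] at h
end
end

section
/- Let Φ be a quantum channel on M_n(ℂ) and let D ∈ M_n(ℂ) be positive definite with Tr(D Φ(x)) = Tr(D x) for all x ∈ M_n(ℂ). If a, b ∈ M_n(ℂ) satisfy Φ(a) = a and Φ(b) = b, then Φ(a x b) = a Φ(x) b for every x ∈ M_n(ℂ). -/
open Matrix
open scoped ComplexOrder

noncomputable section

open scoped MatrixOrder in
lemma psd_factor {m : Type} [Fintype m] [DecidableEq m] {A : Matrix m m ℂ}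
    (hA : A.PosSemidef) : ∃ B : Matrix m m ℂ, A = Bᴴ * B :=
  CStarAlgebra.nonneg_iff_eq_star_mul_self.mp hA.nonneg

lemma cp_factor {n : ℕ} (Φ : Mat n →ₗ[ℂ] Mat n) (h : IsCompletelyPositive n Φ)
    (c : Fin 3 → Mat n) :
    ∃ N : Fin 3 → Matrix (Fin 3 × Fin n) (Fin n) ℂ,
      ∀ p q, (N p)ᴴ * N q = Φ ((c p)ᴴ * c q) := by
  let G : Matrix (Fin n) (Fin 3 × Fin n) ℂ := Matrix.of fun i q => c q.1 i q.2
  have h1 := h 3 (by norm_num) _ (posSemidef_conjTranspose_mul_self G)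
  obtain ⟨B, hB⟩ := psd_factor h1
  refine ⟨fun p => Matrix.of fun r j => B r (p, j), fun p q => ?_⟩
  ext i j
  have h2 := congrFun (congrFun hB (p, i)) (q, j)
  have h3 : (Matrix.of fun i j => (Gᴴ * G) (p, i) (q, j)) = (c p)ᴴ * c q := by
    ext i j
    simp [G, Matrix.mul_apply]
  simp only [blockMap, Matrix.of_apply] at h2
  rw [h3] at h2
  rw [h2]
  simp [Matrix.mul_apply]

lemma eq_zero_of_trace {n : ℕ} {m : Type} [Fintype m] (D : Mat n) (hD : D.PosDef)
    (W : Matrix m (Fin n) ℂ) (h : (D * (Wᴴ * W)).trace = 0) : W = 0 := by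
  obtain ⟨C, hC⟩ := psd_factor hD.posSemidef
  have h1 : ((W * Cᴴ)ᴴ * (W * Cᴴ)).trace = 0 := by
    rw [← h, hC, Matrix.conjTranspose_mul, Matrix.conjTranspose_conjTranspose,
      ← Matrix.mul_assoc, Matrix.trace_mul_comm]
    simp only [Matrix.mul_assoc]
  rw [Matrix.trace_conjTranspose_mul_self_eq_zero_iff] at h1
  have h2 : W * D = 0 := by rw [hC, ← Matrix.mul_assoc, h1, Matrix.zero_mul]
  have h3 : IsUnit D.det := (Matrix.isUnit_iff_isUnit_det _).mp hD.isUnit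
  calc W = W * D * D⁻¹ := by rw [Matrix.mul_assoc, Matrix.mul_nonsing_inv _ h3, Matrix.mul_one]
    _ = 0 := by rw [h2, Matrix.zero_mul]

lemma channel_star {n : ℕ} (Φ : Mat n →ₗ[ℂ] Mat n)
    (hΦ : IsQuantumChannel n Φ) (x : Mat n) : Φ xᴴ = (Φ x)ᴴ := by
  obtain ⟨N, hN⟩ := cp_factor Φ hΦ.1 ![1, x, 1]
  have h1 := hN 0 1
  have h2 := hN 1 0
  simp at h1 h2
  rw [← h1, ← h2]
  simp

lemma right_mod {n : ℕ} (Φ : Mat n →ₗ[ℂ] Mat n)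
    (hΦ : IsQuantumChannel n Φ) (D : Mat n) (hD : D.PosDef)
    (hinv : ∀ x : Mat n, (D * Φ x).trace = (D * x).trace)
    (a : Mat n) (ha : Φ a = a) (y : Mat n) : Φ (y * a) = Φ y * a := by
  obtain ⟨N, hN⟩ := cp_factor Φ hΦ.1 ![1, a, yᴴ]
  have h00 := hN 0 0
  have h01 := hN 0 1
  have h10 := hN 1 0
  have h11 := hN 1 1
  have h20 := hN 2 0
  have h21 := hN 2 1
  simp [hΦ.2, ha, channel_star Φ hΦ a] at h00 h01 h10 h11 h20 h21
  have hW : (N 1 - N 0 * a)ᴴ * (N 1 - N 0 * a) = Φ (aᴴ * a) - aᴴ * a := by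
    rw [Matrix.conjTranspose_sub, Matrix.conjTranspose_mul, Matrix.sub_mul, Matrix.mul_sub,
      Matrix.mul_sub, h11, ← Matrix.mul_assoc, h10, Matrix.mul_assoc aᴴ, h01,
      Matrix.mul_assoc aᴴ, ← Matrix.mul_assoc _ (N 0), h00]
    simp
  have h0 : N 1 - N 0 * a = 0 := by
    apply eq_zero_of_trace D hD
    rw [hW, Matrix.mul_sub, Matrix.trace_sub, hinv, sub_self]
  rw [← h21, ← h20, sub_eq_zero.mp h0, Matrix.mul_assoc]

/-- For a quantum channel `Φ` with a faithful invariant state, fixed points can be pulled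
out of `Φ` as a bimodule property: `Φ(a x b) = a Φ(x) b` whenever `Φ(a) = a`, `Φ(b) = b`. -/
theorem fixedPoint_bimodule {n : ℕ} (Φ : Mat n →ₗ[ℂ] Mat n)
    (hΦ : IsQuantumChannel n Φ) (D : Mat n) (hD : D.PosDef)
    (hinv : ∀ x : Mat n, (D * Φ x).trace = (D * x).trace)
    (a b : Mat n) (ha : Φ a = a) (hb : Φ b = b) :
    ∀ x : Mat n, Φ (a * x * b) = a * Φ x * b := by
  intro x
  have hl : ∀ y, Φ (a * y) = a * Φ y := by
    intro y
    have h := right_mod Φ hΦ D hD hinv aᴴ (by rw [channel_star Φ hΦ, ha]) yᴴ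
    rw [← Matrix.conjTranspose_mul, channel_star Φ hΦ, channel_star Φ hΦ,
      ← Matrix.conjTranspose_mul] at h
    exact Matrix.conjTranspose_injective h
  rw [right_mod Φ hΦ D hD hinv b hb, hl]
end
end
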